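/- arXiv:1505.06320 — 2 statements merged into one kernel-verified Lean document; each statement's English description precedes it below -/
import Mathlib

section
/- For every nonzero countable ordinal θ and every pruned tree T, every set in D_θ([T]) is a quasi-difference set, i.e. D_θ([T]) ⊆ 𝒟([T]). -/
/-! Basic setup: trees of finite sequences, their branches, the topology on the set of
branches, the Hausdorff difference hierarchy, quasi-difference sets, and infinite
games in extensive form. -/

/-- `T` is a tree over `α`: a set of finite sequences closed under taking prefixes. -/
def IsTree {α : Type*} (T : Set (List α)) : Prop :=
  ∀ ⦃γ δ : List α⦄, γ <+: δ → δ ∈ T → γ ∈ T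

/-- `succ(T, γ)`: the nodes of `T` extending `γ` and of length `|γ| + 1`. -/
def treeSucc {α : Type*} (T : Set (List α)) (γ : List α) : Set (List α) :=
  {δ | δ ∈ T ∧ γ <+: δ ∧ δ.length = γ.length + 1}

/-- `T` is pruned if every node has a successor. -/
def IsPruned {α : Type*} (T : Set (List α)) : Prop :=
  ∀ γ ∈ T, (treeSucc T γ).Nonempty

/-- The finite prefix of length `n` of an infinite sequence `p`. -/
def playPrefix {α : Type*} (p : ℕ → α) (n : ℕ) : List α :=
  List.ofFn fun i : Fin n => p i

/-- `[T]`: the infinite sequences all of whose finite prefixes lie in `T`. -/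
def Body {α : Type*} (T : Set (List α)) : Set (ℕ → α) :=
  {p | ∀ n : ℕ, playPrefix p n ∈ T}

/-- `γ[T_γ]`: the elements of `[T]` extending the node `γ`. -/
def cylinder {α : Type*} (T : Set (List α)) (γ : List α) : Set (ℕ → α) :=
  {p | p ∈ Body T ∧ playPrefix p γ.length = γ}

/-- Open subsets of `[T]`: the unions of basic sets `γ[T_γ]`, `γ ∈ T`. -/
def IsOpenIn {α : Type*} (T : Set (List α)) (A : Set (ℕ → α)) : Prop :=
  ∃ S ⊆ T, A = ⋃ γ ∈ S, cylinder T γ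

/-- Closed subsets of `[T]`: complements in `[T]` of open subsets of `[T]`. -/
def IsClosedIn {α : Type*} (T : Set (List α)) (A : Set (ℕ → α)) : Prop :=
  A ⊆ Body T ∧ IsOpenIn T (Body T \ A)

/-- Borel subsets of `[T]`: members of the σ-algebra generated by the open
subsets of `[T]` that are themselves included in `[T]`. -/
def IsBorelIn {α : Type*} (T : Set (List α)) (X : Set (ℕ → α)) : Prop :=
  X ⊆ Body T ∧
    @MeasurableSet (ℕ → α) (MeasurableSpace.generateFrom {A | IsOpenIn T A}) X

/-- `D_θ((A_η)_{η<θ})`: the set of `x ∈ ⋃_{η<θ} A_η` such that the least `η < θ`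
with `x ∈ A_η` has parity opposite to that of `θ`. -/
noncomputable def Dset {α : Type*} (θ : Ordinal.{0}) (A : Ordinal.{0} → Set (ℕ → α)) :
    Set (ℕ → α) :=
  {x | (∃ η < θ, x ∈ A η) ∧ sInf {η | η < θ ∧ x ∈ A η} % 2 ≠ θ % 2}

/-- `D_θ([T])`: all sets of the form `D_θ((A_η)_{η<θ})` for an `⊆`-increasing family
of open subsets of `[T]`. -/
def Dclass {α : Type*} (T : Set (List α)) (θ : Ordinal.{0}) : Set (Set (ℕ → α)) :=
  {X | ∃ A : Ordinal.{0} → Set (ℕ → α),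
        (∀ η < θ, IsOpenIn T (A η)) ∧
        (∀ η₁ η₂, η₁ ≤ η₂ → η₂ < θ → A η₁ ⊆ A η₂) ∧
        X = Dset θ A}

/-- The quasi-difference sets `𝒟([T])`: open sets, unions of quasi-difference sets
placed below pairwise `⊑`-incomparable nodes, and complements in `[T]`. -/
inductive QuasiDiff {α : Type*} (T : Set (List α)) : Set (ℕ → α) → Prop
  | isOpen : ∀ A, IsOpenIn T A → QuasiDiff T A
  | iUnion : ∀ (S : Set (List α)) (D : List α → Set (ℕ → α)),
      S ⊆ T → (S.Pairwise fun γ δ => ¬ γ <+: δ) →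
      (∀ γ ∈ S, QuasiDiff T (D γ)) →
      (∀ γ ∈ S, D γ ⊆ cylinder T γ) →
      QuasiDiff T (⋃ γ ∈ S, D γ)
  | compl : ∀ A, QuasiDiff T A → QuasiDiff T (Body T \ A)

/-- An infinite game in extensive form: a tree `T` of finite plays, an owner function `d`,
an outcome function `v` on infinite plays, and a preference relation for each player. -/
structure Game (α A O : Type*) where
  T : Set (List α)
  d : List α → A
  v : (ℕ → α) → O
  pref : A → O → O → Prop

/-- The infinite sequence starting with `γ` and continuing with `p`. -/
def listExtend {α : Type*} (γ : List α) (p : ℕ → α) : ℕ → α :=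
  fun n => if h : n < γ.length then γ.get ⟨n, h⟩ else p (n - γ.length)

/-- The subgame `g_γ` of `g` at a node `γ`. -/
def Game.sub {α A O : Type*} (g : Game α A O) (γ : List α) : Game α A O where
  T := {δ | γ ++ δ ∈ g.T}
  d := fun δ => g.d (γ ++ δ)
  v := fun p => g.v (listExtend γ p)
  pref := g.pref

/-- A strategy profile on `T`: it maps each node of `T` to a successor. -/
def IsProfile {α : Type*} (T : Set (List α)) (s : List α → List α) : Prop :=
  ∀ γ ∈ T, s γ ∈ treeSucc T γ

/-- The sequence of nodes obtained from `γ` by repeatedly applying `s`. -/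
def iterNode {α : Type*} (s : List α → List α) (γ : List α) : ℕ → List α
  | 0 => γ
  | n + 1 => s (iterNode s γ n)

/-- The play `p^ε(s)` induced by `s` at the root. -/
def inducedPlay {α : Type*} [Inhabited α] (s : List α → List α) : ℕ → α :=
  fun n => (iterNode s [] (n + 1)).getD n default

/-- The subprofile `s_γ`, defined by `γ s_γ(δ) = s(γδ)`. -/
def subProfile {α : Type*} (γ : List α) (s : List α → List α) : List α → List α :=
  fun δ => (s (γ ++ δ)).drop γ.length

/-- `s` is a Nash equilibrium of `g`: no player `a` has a profitable deviation `s'`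
differing from `s` only at nodes owned by `a`. -/
def IsNE {α A O : Type*} [Inhabited α] (g : Game α A O) (s : List α → List α) : Prop :=
  ¬ ∃ (a : A) (s' : List α → List α), IsProfile g.T s' ∧
      (∀ γ ∈ g.T, s γ ≠ s' γ → g.d γ = a) ∧
      g.pref a (g.v (inducedPlay s)) (g.v (inducedPlay s'))

/-- `s` is a subgame perfect equilibrium of `g`: `s_γ` is an NE of `g_γ` for all `γ ∈ T`. -/
def IsSPE {α A O : Type*} [Inhabited α] (g : Game α A O) (s : List α → List α) : Prop :=
  ∀ γ ∈ g.T, IsNE (g.sub γ) (subProfile γ s)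

/-- The outcomes occurring in `g`. -/
def OutcomesOf {α A O : Type*} (g : Game α A O) : Set O := g.v '' Body g.T

/-- `x ∈ Os` is Pareto-optimal in `Os`. -/
def ParetoOpt {A O : Type*} (pref : A → O → O → Prop) (Os : Set O) (x : O) : Prop :=
  x ∈ Os ∧ ∀ y ∈ Os, ∀ a, pref a x y → ∃ b, pref b y x

/-- The outcome induced by the subprofile `s_γ` in the subgame `g_γ`. -/
def subOutcome {α A O : Type*} [Inhabited α] (g : Game α A O) (s : List α → List α)
    (γ : List α) : O :=
  (g.sub γ).v (inducedPlay (subProfile γ s))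

/-- Global-Pareto SPE: an SPE inducing in every subgame an outcome that is
Pareto-optimal among the outcomes occurring in that subgame. -/
def IsGPSPE {α A O : Type*} [Inhabited α] (g : Game α A O) (s : List α → List α) : Prop :=
  IsSPE g s ∧ ∀ γ ∈ g.T, ParetoOpt g.pref (OutcomesOf (g.sub γ)) (subOutcome g s γ)

/-- An `x`-pseudo-leaf: a shortest node `γ ∈ T` such that only `x` occurs in `g_γ`. -/
def IsPseudoLeaf {α A O : Type*} (g : Game α A O) (x : O) (γ : List α) : Prop :=
  γ ∈ g.T ∧ OutcomesOf (g.sub γ) = {x} ∧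
    ∀ δ, δ <+: γ → δ ≠ γ → OutcomesOf (g.sub δ) ≠ {x}

/-- A strict weak order: irreflexive, transitive, with transitive complement. -/
def IsSWO {O : Type*} (r : O → O → Prop) : Prop :=
  (∀ x, ¬ r x x) ∧ (∀ x y z, r x y → r y z → r x z) ∧
  (∀ x y z, ¬ r x y → ¬ r y z → ¬ r x z)

/-- The SPE killer does not occur in the family of preferences `lt`. -/
def NoSPEKiller {A O : Type*} (lt : A → O → O → Prop) : Prop :=
  ∀ a b : A, ∀ x y z : O, ¬ (lt a z y ∧ lt a y x ∧ lt b x z ∧ lt b z y)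

theorem playPrefix_length {α : Type*} (p : ℕ → α) (n : ℕ) : (playPrefix p n).length = n := by
  simp [playPrefix]

theorem playPrefix_eq_iff {α : Type*} (p q : ℕ → α) (n : ℕ) :
    playPrefix p n = playPrefix q n ↔ ∀ i < n, p i = q i := by
  unfold playPrefix
  rw [List.ofFn_inj]
  constructor
  · intro h i hi
    exact congrFun h ⟨i, hi⟩
  · intro h
    funext i
    exact h i i.2

theorem prefix_playPrefix {α : Type*} (p : ℕ → α) (n : ℕ) (δ : List α)
    (h : δ <+: playPrefix p n) : δ.length ≤ n ∧ δ = playPrefix p δ.length := by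
  have hl := h.length_le
  rw [playPrefix_length] at hl
  refine ⟨hl, ?_⟩
  apply List.ext_getElem
  · rw [playPrefix_length]
  · intro i h1 h2
    rw [h.getElem h1]
    simp [playPrefix]

theorem mem_cyl_playPrefix {α : Type*} (T : Set (List α)) (p q : ℕ → α) (n : ℕ) :
    q ∈ cylinder T (playPrefix p n) ↔ q ∈ Body T ∧ ∀ i < n, q i = p i := by
  unfold cylinder
  rw [Set.mem_ofPred_eq, playPrefix_length, playPrefix_eq_iff]

theorem isOpenIn_iff {α : Type*} (T : Set (List α)) (A : Set (ℕ → α)) :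
    IsOpenIn T A ↔ A ⊆ Body T ∧ ∀ x ∈ A, ∃ n, cylinder T (playPrefix x n) ⊆ A := by
  constructor
  · rintro ⟨S, hS, rfl⟩
    constructor
    · intro x hx
      simp only [Set.mem_iUnion] at hx
      obtain ⟨γ, _, hx⟩ := hx
      exact hx.1
    · intro x hx
      simp only [Set.mem_iUnion] at hx
      obtain ⟨γ, hγ, hx⟩ := hx
      refine ⟨γ.length, ?_⟩
      rw [hx.2]
      exact Set.subset_biUnion_of_mem (u := fun γ => cylinder T γ) hγ
  · rintro ⟨h1, h2⟩
    refine ⟨{γ | γ ∈ T ∧ cylinder T γ ⊆ A}, fun γ h => h.1, ?_⟩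
    ext x
    simp only [Set.mem_iUnion]
    constructor
    · intro hx
      obtain ⟨n, hn⟩ := h2 x hx
      exact ⟨playPrefix x n, ⟨h1 hx n, hn⟩, by
        rw [mem_cyl_playPrefix]; exact ⟨h1 hx, fun _ _ => rfl⟩⟩
    · rintro ⟨γ, hγ, hx⟩
      exact hγ.2 hx

theorem isOpenIn_inter_cyl {α : Type*} (T : Set (List α)) (A : Set (ℕ → α))
    (hA : IsOpenIn T A) (γ : List α) : IsOpenIn T (A ∩ cylinder T γ) := by
  rw [isOpenIn_iff] at *
  refine ⟨fun x hx => hA.1 hx.1, ?_⟩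
  rintro x ⟨hx, hxγ⟩
  obtain ⟨n, hn⟩ := hA.2 x hx
  refine ⟨max n γ.length, ?_⟩
  intro y hy
  rw [mem_cyl_playPrefix] at hy
  refine ⟨hn ?_, hy.1, ?_⟩
  · rw [mem_cyl_playPrefix]
    exact ⟨hy.1, fun i hi => hy.2 i (lt_of_lt_of_le hi (le_max_left _ _))⟩
  · rw [← hxγ.2, playPrefix_length, playPrefix_eq_iff]
    exact fun i hi => hy.2 i (lt_of_lt_of_le hi (le_max_right _ _))

theorem quasiDiff_cyl_diff {α : Type*} (T : Set (List α)) (γ : List α) (hγ : γ ∈ T)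
    (Q : Set (ℕ → α)) (hQ : QuasiDiff T Q) (hQγ : Q ⊆ cylinder T γ) :
    QuasiDiff T (cylinder T γ \ Q) := by
  classical
  have key := QuasiDiff.compl _ (QuasiDiff.iUnion (T := T) {δ | δ ∈ T ∧ δ.length = γ.length}
    (fun δ => if δ = γ then Q else cylinder T δ) (fun δ h => h.1)
    (by
      rintro a ⟨_, ha⟩ b ⟨_, hb⟩ hab h
      exact hab (h.eq_of_length (ha.trans hb.symm)))
    (by
      rintro δ ⟨hδ, _⟩
      split_ifs with h
      · exact hQ
      · exact QuasiDiff.isOpen _ ⟨{δ}, by simpa using hδ, by simp⟩)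
    (by
      rintro δ ⟨hδ, _⟩
      split_ifs with h
      · rw [h]; exact hQγ
      · exact subset_rfl))
  convert key using 1
  ext x
  simp only [Set.mem_sdiff, Set.mem_iUnion, Set.mem_ofPred_eq, not_exists]
  constructor
  · rintro ⟨hx, hxQ⟩
    refine ⟨hx.1, ?_⟩
    rintro δ ⟨hδ, hl⟩ h
    split_ifs at h with he
    · exact hxQ h
    · apply he
      rw [← h.2, hl, hx.2]
  · rintro ⟨hx, h⟩
    constructor
    · by_contra hc
      apply h (playPrefix x γ.length) ⟨hx _, playPrefix_length _ _⟩
      rw [if_neg]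
      · rw [mem_cyl_playPrefix]; exact ⟨hx, fun _ _ => rfl⟩
      · intro he; exact hc ⟨hx, he⟩
    · intro hQx
      apply h γ ⟨hγ, rfl⟩
      rw [if_pos rfl]; exact hQx

theorem ord_mod_two (a : Ordinal.{0}) : a % 2 = 0 ∨ a % 2 = 1 := by
  have h : a % 2 < 2 := Ordinal.mod_lt a (by simp)
  have h2 : a % 2 ≤ 1 := by
    rw [← Order.lt_succ_iff]
    simpa [one_add_one_eq_two] using h
  rcases h2.lt_or_eq with h | h
  · left; simpa using h
  · right; exact h

theorem mem_Dset_iff {α : Type*} (θ : Ordinal.{0}) (A : Ordinal.{0} → Set (ℕ → α)) (x : ℕ → α) :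
    x ∈ Dset θ A ↔ ∃ m < θ, x ∈ A m ∧ (∀ k < m, x ∉ A k) ∧ m % 2 ≠ θ % 2 := by
  have hinf : ∀ m < θ, x ∈ A m → (∀ k < m, x ∉ A k) → sInf {η | η < θ ∧ x ∈ A η} = m := by
    intro m hm hx hk
    apply le_antisymm
    · exact csInf_le' (s := {η | η < θ ∧ x ∈ A η}) ⟨hm, hx⟩
    · apply le_csInf (s := {η | η < θ ∧ x ∈ A η}) ⟨m, hm, hx⟩
      rintro b ⟨_, hb⟩
      by_contra hlt
      exact hk b (not_le.1 hlt) hb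
  constructor
  · rintro ⟨⟨η, hη, hx⟩, h⟩
    have hm := csInf_mem (s := {η | η < θ ∧ x ∈ A η}) ⟨η, hη, hx⟩
    refine ⟨_, hm.1, hm.2, ?_, h⟩
    intro k hk hxk
    exact notMem_of_lt_csInf' hk ⟨hk.trans hm.1, hxk⟩
  · rintro ⟨m, hm, hx, hk, hp⟩
    refine ⟨⟨m, hm, hx⟩, ?_⟩
    rw [hinf m hm hx hk]; exact hp

theorem Dset_quasiDiff {α : Type*} (T : Set (List α)) (θ : Ordinal.{0}) :
    ∀ A : Ordinal.{0} → Set (ℕ → α), (∀ η < θ, IsOpenIn T (A η)) → QuasiDiff T (Dset θ A) := by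
  induction θ using WellFoundedLT.induction with
  | ind θ ih =>
  intro A hA
  let P : List α → Prop := fun γ => ∃ η < θ, cylinder T γ ⊆ A η
  let S : Set (List α) := {γ | γ ∈ T ∧ P γ ∧ ∀ δ, δ <+: γ → P δ → δ = γ}
  have hX : Dset θ A = ⋃ γ ∈ S, (Dset θ A ∩ cylinder T γ) := by
    ext x
    simp only [Set.mem_iUnion]
    constructor
    · intro hx
      obtain ⟨η, hη, hxη⟩ := hx.1
      obtain ⟨hB, hn⟩ := (isOpenIn_iff T _).1 (hA η hη)
      have hxB := hB hxη
      obtain ⟨n, hn⟩ := hn x hxη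
      classical
      have hex : ∃ n, P (playPrefix x n) := ⟨n, η, hη, hn⟩
      refine ⟨playPrefix x (Nat.find hex), ⟨hxB _, Nat.find_spec hex, ?_⟩, hx, ?_⟩
      · intro δ hδ hP
        obtain ⟨h1, h2⟩ := prefix_playPrefix _ _ _ hδ
        rw [h2] at hP
        have h3 := Nat.find_min' hex hP
        rw [h2]
        congr 1
        exact le_antisymm h1 h3
      · rw [mem_cyl_playPrefix]; exact ⟨hxB, fun _ _ => rfl⟩
    · rintro ⟨γ, _, h⟩
      exact h.1
  rw [hX]
  apply QuasiDiff.iUnion S (fun γ => Dset θ A ∩ cylinder T γ) (fun γ h => h.1)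
  · intro a ha b hb hab h
    exact hab (hb.2.2 a h ha.2.1)
  · rintro γ ⟨hγ, ⟨η, hη, hsub⟩, -⟩
    have hQ := ih η hη (fun ζ => A ζ ∩ cylinder T γ)
      (fun ζ hζ => isOpenIn_inter_cyl T _ (hA ζ (hζ.trans hη)) γ)
    have hQsub : Dset η (fun ζ => A ζ ∩ cylinder T γ) ⊆ cylinder T γ := by
      rintro x ⟨⟨ζ, _, hx⟩, _⟩
      exact hx.2
    -- the least index of a point of the cylinder
    have hleast : ∀ x ∈ cylinder T γ, ∃ m ≤ η, x ∈ A m ∧ ∀ k < m, x ∉ A k := by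
      intro x hx
      have hm := csInf_mem (s := {ζ | x ∈ A ζ}) ⟨η, hsub hx⟩
      exact ⟨_, csInf_le' (s := {ζ | x ∈ A ζ}) (hsub hx), hm,
        fun k hk => notMem_of_lt_csInf' (s := {ζ | x ∈ A ζ}) hk⟩
    have h1 : ∀ x ∈ cylinder T γ, ∀ m ≤ η, x ∈ A m → (∀ k < m, x ∉ A k) → ∀ ξ,
        (∀ B : Ordinal.{0} → Set (ℕ → α), (∀ ζ, x ∈ B ζ ↔ x ∈ A ζ) →
          (x ∈ Dset ξ B ↔ m < ξ ∧ m % 2 ≠ ξ % 2)) := by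
      intro x hx m hm hxm hk ξ B hB
      rw [mem_Dset_iff]
      simp only [hB]
      constructor
      · rintro ⟨m', h1, h2, h3, h4⟩
        have : m' = m := by
          rcases lt_trichotomy m' m with h | h | h
          · exact absurd h2 (hk _ h)
          · exact h
          · exact absurd hxm (h3 _ h)
        subst this
        exact ⟨h1, h4⟩
      · rintro ⟨h1, h2⟩
        exact ⟨m, h1, hxm, hk, h2⟩
    by_cases hpar : η % 2 = θ % 2
    · convert hQ using 1
      ext x
      constructor
      · rintro ⟨hxD, hx⟩
        obtain ⟨m, hm, hxm, hk⟩ := hleast x hx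
        rw [h1 x hx m hm hxm hk _ _ (fun ζ => Iff.rfl)] at hxD
        rw [h1 x hx m hm hxm hk _ (fun ζ => A ζ ∩ cylinder T γ) (fun ζ => ⟨fun h => h.1, fun h => ⟨h, hx⟩⟩)]
        refine ⟨lt_of_le_of_ne hm ?_, by rw [hpar]; exact hxD.2⟩
        rintro rfl
        exact hxD.2 hpar
      · intro hxD
        have hx := hQsub hxD
        refine ⟨?_, hx⟩
        obtain ⟨m, hm, hxm, hk⟩ := hleast x hx
        rw [h1 x hx m hm hxm hk _ (fun ζ => A ζ ∩ cylinder T γ) (fun ζ => ⟨fun h => h.1, fun h => ⟨h, hx⟩⟩)] at hxD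
        rw [h1 x hx m hm hxm hk _ _ (fun ζ => Iff.rfl)]
        exact ⟨hxD.1.trans hη, by rw [← hpar]; exact hxD.2⟩
    · convert quasiDiff_cyl_diff T γ hγ _ hQ hQsub using 1
      ext x
      rw [Set.mem_inter_iff, Set.mem_sdiff, and_comm]
      apply and_congr_right
      intro hx
      obtain ⟨m, hm, hxm, hk⟩ := hleast x hx
      rw [h1 x hx m hm hxm hk _ (fun ζ => A ζ ∩ cylinder T γ) (fun ζ => ⟨fun h => h.1, fun h => ⟨h, hx⟩⟩),
        h1 x hx m hm hxm hk _ _ (fun ζ => Iff.rfl)]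
      constructor
      · rintro ⟨_, h⟩ ⟨_, h'⟩
        rcases ord_mod_two m with a | a <;> rcases ord_mod_two η with b | b <;>
          rcases ord_mod_two θ with c | c <;> simp_all
      · intro h
        refine ⟨hm.trans_lt hη, fun he => ?_⟩
        apply h
        refine ⟨lt_of_le_of_ne hm ?_, fun h' => hpar (h'.symm.trans he)⟩
        rintro rfl
        exact hpar he
  · intro γ _ x hx
    exact hx.2

/-- `D_θ([T]) ⊆ 𝒟([T])` for every nonzero countable ordinal `θ`
and pruned tree `T`. -/
theorem stmt2 {α : Type*} (T : Set (List α)) (hT : IsTree T) (hpr : IsPruned T)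
    (θ : Ordinal.{0}) (hθ : θ ≠ 0) (hcount : θ.card ≤ Cardinal.aleph0)
    (X : Set (ℕ → α)) (hX : X ∈ Dclass T θ) :
    QuasiDiff T X := by
  obtain ⟨A, hA, -, rfl⟩ := hX
  exact Dset_quasiDiff T θ A hA
end

section
/- Let g be an infinite game with two players a and b, outcomes {y, x_1, …, x_n} for some n ≥ 0, strict linear preferences y <_a x_n <_a ⋯ <_a x_1 and y <_b x_1 <_b ⋯ <_b x_n, and suppose that every play of g no prefix of which is a pseudo-leaf has outcome y. Then g has a global-Pareto subgame perfect equilibrium. -/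
/-- Player `a`'s preference `y <_a x_n <_a ⋯ <_a x_1`, where `y` is the outcome `0`
and `x_i` is the outcome `i` in `Fin (n+1)`. -/
def prefA (n : ℕ) : Fin (n + 1) → Fin (n + 1) → Prop :=
  fun u v => v ≠ 0 ∧ (u = 0 ∨ v < u)

/-- Player `b`'s preference `y <_b x_1 <_b ⋯ <_b x_n`, where `y` is the outcome `0`
and `x_i` is the outcome `i` in `Fin (n+1)`. -/
def prefB (n : ℕ) : Fin (n + 1) → Fin (n + 1) → Prop :=
  fun u v => u < v


section Abstract

/-- `γ` reaches `X` inside `H` in `m` steps. -/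
inductive Reach {N : Type*} (E : N → N → Prop) (H X : Set N) : ℕ → N → Prop
  | base : ∀ γ, γ ∈ H → γ ∈ X → Reach E H X 0 γ
  | step : ∀ m γ δ, γ ∈ H → E γ δ → Reach E H X m δ → Reach E H X (m + 1) γ

theorem Reach.mono {N : Type*} {E : N → N → Prop} {H H' X X' : Set N} (h : H ⊆ H')
    (hX : X ⊆ X') {m : ℕ} {γ : N} (r : Reach E H X m γ) : Reach E H' X' m γ := by
  induction r with
  | base γ h1 h2 => exact .base _ (h h1) (hX h2)
  | step m γ δ h1 h2 _ ih => exact .step _ _ _ (h h1) h2 ih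

theorem Reach.mem {N : Type*} {E : N → N → Prop} {H X : Set N}
    {m : ℕ} {γ : N} (r : Reach E H X m γ) : γ ∈ H := by
  cases r <;> assumption

/-- Good sets at level `k`. -/
def GoodSet {N : Type*} (E : N → N → Prop) (own : N → Bool) (X C H : Set N) : Prop :=
  H ⊆ C ∧ ∀ γ ∈ H, (own γ = false → ∀ δ, E γ δ → δ ∈ C → δ ∈ H) ∧ ∃ m, Reach E H X m γ

/-- Largest good set. -/
def GG {N : Type*} (E : N → N → Prop) (own : N → Bool) (X C : Set N) : Set N :=
  {γ | ∃ H, GoodSet E own X C H ∧ γ ∈ H}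

theorem GG_good {N : Type*} (E : N → N → Prop) (own : N → Bool) (X C : Set N) :
    GoodSet E own X C (GG E own X C) := by
  refine ⟨?_, ?_⟩
  · rintro γ ⟨H, hH, hγ⟩
    exact hH.1 hγ
  · rintro γ ⟨H, hH, hγ⟩
    refine ⟨fun ho δ hE hC => ⟨H, hH, (hH.2 γ hγ).1 ho δ hE hC⟩, ?_⟩
    obtain ⟨m, hm⟩ := (hH.2 γ hγ).2
    exact ⟨m, hm.mono (show H ⊆ GG E own X C from fun x hx => ⟨H, hH, hx⟩) subset_rfl⟩

/-- Leaves of label `> k`. -/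
def Lgt {N : Type*} (L : ℕ → Set N) (k : ℕ) : Set N := {γ | ∃ j, k < j ∧ γ ∈ L j}

/-- The residual sets. -/
def CC {N : Type*} (E : N → N → Prop) (own : N → Bool) (L : ℕ → Set N) : ℕ → Set N
  | 0 => {γ | ∃ m, Reach E Set.univ (Lgt L 0) m γ}
  | k + 1 => CC E own L k \ GG E own (L (k + 1)) (CC E own L k)

theorem CC_anti {N : Type*} (E : N → N → Prop) (own : N → Bool) (L : ℕ → Set N) :
    Antitone (CC E own L) := antitone_nat_of_succ_le fun _ _ h => h.1

theorem CC_live {N : Type*} (E : N → N → Prop) (own : N → Bool) (L : ℕ → Set N)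
    (hL : ∀ k γ δ, γ ∈ L k → E γ δ → δ ∈ L k) (k : ℕ) :
    ∀ γ ∈ CC E own L k, ∃ m, Reach E (CC E own L k) (Lgt L k) m γ := by
  induction k with
  | zero =>
    rintro γ ⟨m, hm⟩
    refine ⟨m, ?_⟩
    induction hm with
    | base γ h1 h2 => exact .base _ ⟨0, .base _ h1 h2⟩ h2
    | step m γ δ h1 h2 h3 ih => exact .step _ _ _ ⟨m + 1, .step _ _ _ h1 h2 h3⟩ h2 ih
  | succ k ih =>
    intro γ hγ
    by_contra hno
    set C := CC E own L k with hC
    set G := GG E own (L (k + 1)) C with hG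
    have hgood := GG_good E own (L (k + 1)) C
    rw [← hG] at hgood
    have hC' : CC E own L (k + 1) = C \ G := rfl
    let D : Set N := {γ | γ ∈ C \ G ∧ ¬ ∃ m, Reach E (C \ G) (Lgt L (k + 1)) m γ}
    have hleaf : ∀ γ ∈ C, γ ∈ L (k + 1) → γ ∈ G := by
      intro γ h1 h2
      refine ⟨C ∩ L (k + 1), ⟨Set.inter_subset_left, ?_⟩, h1, h2⟩
      intro γ h
      exact ⟨fun _ δ hE hδ => ⟨hδ, hL _ _ _ h.2 hE⟩, 0, .base _ h h.2⟩
    have key : ∀ m γ, Reach E C (Lgt L k) m γ → γ ∈ D → ∃ m, Reach E (D ∪ G) (L (k + 1)) m γ := by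
      intro m γ hr
      induction hr with
      | base γ h1 h2 =>
        intro hD
        obtain ⟨j, hj, hjL⟩ := h2
        rcases (Nat.succ_le_of_lt hj).eq_or_lt with rfl | hlt
        · exact absurd (hleaf γ h1 hjL) hD.1.2
        · exact (hD.2 ⟨0, .base _ hD.1 ⟨j, hlt, hjL⟩⟩).elim
      | step m γ δ h1 h2 h3 ih' =>
        intro hD
        by_cases hδ : δ ∈ G
        · obtain ⟨m, hm⟩ := (hgood.2 δ hδ).2
          exact ⟨m + 1, .step _ _ _ (Or.inl hD) h2 (hm.mono Set.subset_union_right subset_rfl)⟩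
        · have : δ ∈ D := by
            refine ⟨⟨h3.mem, hδ⟩, ?_⟩
            rintro ⟨m, hm⟩
            exact hD.2 ⟨m + 1, .step _ _ _ hD.1 h2 hm⟩
          obtain ⟨m, hm⟩ := ih' this
          exact ⟨m + 1, .step _ _ _ (Or.inl hD) h2 hm⟩
    have hDG : GoodSet E own (L (k + 1)) C (D ∪ G) := by
      refine ⟨?_, ?_⟩
      · rintro x (hx | hx)
        · exact hx.1.1
        · exact hgood.1 hx
      · rintro x (hx | hx)
        · refine ⟨fun ho δ hE hδ => ?_, ?_⟩
          · by_cases hδG : δ ∈ G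
            · exact Or.inr hδG
            · refine Or.inl ⟨⟨hδ, hδG⟩, ?_⟩
              rintro ⟨m, hm⟩
              exact hx.2 ⟨m + 1, .step _ _ _ hx.1 hE hm⟩
          · obtain ⟨m, hm⟩ := ih x hx.1.1
            exact key m x hm hx
        · refine ⟨fun ho δ hE hδ => Or.inr ((hgood.2 x hx).1 ho δ hE hδ), ?_⟩
          obtain ⟨m, hm⟩ := (hgood.2 x hx).2
          exact ⟨m, hm.mono Set.subset_union_right subset_rfl⟩
    exact hγ.2 ⟨_, hDG, Or.inl ⟨hγ, hno⟩⟩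

theorem CC_own_true {N : Type*} (E : N → N → Prop) (own : N → Bool) (L : ℕ → Set N)
    (k : ℕ) : ∀ γ ∈ CC E own L k, own γ = true → ∀ δ, E γ δ → δ ∈ CC E own L 0 →
      δ ∈ CC E own L k := by
  induction k with
  | zero => intro γ _ _ δ _ h; exact h
  | succ k ih =>
    intro γ hγ ho δ hE hδ
    refine ⟨ih γ hγ.1 ho δ hE hδ, fun hG => hγ.2 ?_⟩
    have hgood := GG_good E own (L (k + 1)) (CC E own L k)
    refine ⟨insert γ (GG E own (L (k + 1)) (CC E own L k)), ⟨?_, ?_⟩, Or.inl rfl⟩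
    · rintro x (rfl | hx)
      · exact hγ.1
      · exact hgood.1 hx
    · rintro x (rfl | hx)
      · refine ⟨fun h => by simp [ho] at h, ?_⟩
        obtain ⟨m, hm⟩ := (hgood.2 δ hG).2
        exact ⟨m + 1, .step _ _ _ (Or.inl rfl) hE (hm.mono (Set.subset_insert _ _) subset_rfl)⟩
      · refine ⟨fun ho δ hE hδ => Or.inr ((hgood.2 x hx).1 ho δ hE hδ), ?_⟩
        obtain ⟨m, hm⟩ := (hgood.2 x hx).2
        exact ⟨m, hm.mono (Set.subset_insert _ _) subset_rfl⟩

theorem abstract_val {N : Type*} (E : N → N → Prop) (own : N → Bool) (L : ℕ → Set N) (n : ℕ)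
    (hL : ∀ k γ δ, γ ∈ L k → E γ δ → δ ∈ L k) (hLn : ∀ k, n < k → L k = ∅)
    (hdis : ∀ j k γ, γ ∈ L j → γ ∈ L k → j = k) :
    ∃ val rank : N → ℕ,
      (∀ γ, val γ ≠ 0 ↔ ∃ m, Reach E Set.univ (Lgt L 0) m γ) ∧
      (∀ γ k, 0 < k → γ ∈ L k → val γ = k) ∧
      (∀ γ, val γ ≠ 0 → γ ∈ L (val γ) ∨ ∃ δ, E γ δ ∧ val δ = val γ ∧ rank δ < rank γ) ∧
      (∀ γ δ, val γ ≠ 0 → E γ δ → own γ = true → val δ ≠ 0 → val γ ≤ val δ) ∧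
      (∀ γ δ, val γ ≠ 0 → E γ δ → own γ = false → val δ ≤ val γ) := by
  classical
  have hex : ∀ γ, ∃ k, γ ∉ CC E own L k := by
    intro γ
    refine ⟨n, fun h => ?_⟩
    obtain ⟨m, hm⟩ := CC_live E own L hL n γ h
    clear h
    induction hm with
    | base γ _ h2 => obtain ⟨j, hj, hj'⟩ := h2; simp [hLn j hj] at hj'
    | step _ _ _ _ _ _ ih => exact ih
  let val : N → ℕ := fun γ => Nat.find (hex γ)
  have hval : ∀ γ k, γ ∈ CC E own L k ↔ k < val γ := by
    intro γ k
    constructor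
    · intro h
      by_contra hlt
      exact Nat.find_spec (hex γ) (CC_anti E own L (not_lt.1 hlt) h)
    · intro h
      exact not_not.1 (Nat.find_min (hex γ) h)
  have hG : ∀ γ k, γ ∈ GG E own (L (k + 1)) (CC E own L k) ↔ val γ = k + 1 := by
    intro γ k
    constructor
    · intro h
      have h1 := (hval γ k).1 ((GG_good _ _ _ _).1 h)
      have h2 : ¬ (k + 1 < val γ) := fun h' => ((hval γ (k + 1)).2 h').2 h
      omega
    · intro h
      by_contra h'
      have : γ ∈ CC E own L (k + 1) := ⟨(hval γ k).2 (by omega), h'⟩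
      have := (hval γ (k + 1)).1 this
      omega
  have hreach : ∀ γ, val γ ≠ 0 → ∃ m, Reach E {δ | val δ = val γ} (L (val γ)) m γ := by
    intro γ h
    obtain ⟨k, hk⟩ := Nat.exists_eq_succ_of_ne_zero h
    obtain ⟨m, hm⟩ := ((GG_good E own (L (k + 1)) (CC E own L k)).2 γ ((hG γ k).2 hk)).2
    refine ⟨m, ?_⟩
    rw [hk]
    exact hm.mono (fun x hx => (hG x k).1 hx) subset_rfl
  have hlive : ∀ γ, val γ ≠ 0 ↔ ∃ m, Reach E Set.univ (Lgt L 0) m γ := by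
    intro γ
    rw [← Nat.pos_iff_ne_zero, ← hval γ 0]
    rfl
  refine ⟨val, fun γ => sInf {m | Reach E {δ | val δ = val γ} (L (val γ)) m γ},
    hlive, ?_, ?_, ?_, ?_⟩
  · intro γ k hk hγ
    have h0 : val γ ≠ 0 := (hlive γ).2 ⟨0, .base _ trivial ⟨k, hk, hγ⟩⟩
    obtain ⟨m, hm⟩ := hreach γ h0
    have : ∀ (j : ℕ) (H : Set N), ∀ m γ, Reach E H (L j) m γ → γ ∈ L k → j = k := by
      intro j H m γ hm
      induction hm with
      | base γ _ h2 => intro h; exact hdis _ _ _ h2 h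
      | step m γ δ _ hE _ ih => intro h; exact ih (hL _ _ _ h hE)
    exact this _ _ _ _ hm hγ
  · intro γ h0
    have hm := Nat.sInf_mem (hreach γ h0)
    have hm' : Reach E {δ | val δ = val γ} (L (val γ))
      (sInf {m | Reach E {δ | val δ = val γ} (L (val γ)) m γ}) γ := hm
    generalize hr : sInf {m | Reach E {δ | val δ = val γ} (L (val γ)) m γ} = r at hm'
    cases hm' with
    | base _ _ h => exact Or.inl h
    | step m _ δ h1 hE h2 =>
      right
      have hv : val δ = val γ := h2.mem
      refine ⟨δ, hE, hv, ?_⟩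
      have : sInf {m | Reach E {δ' | val δ' = val δ} (L (val δ)) m δ} ≤ m := by
        apply Nat.sInf_le
        rw [hv]
        exact h2
      show sInf {m | Reach E {δ' | val δ' = val δ} (L (val δ)) m δ} <
        sInf {m | Reach E {δ | val δ = val γ} (L (val γ)) m γ}
      rw [hr]
      omega
  · intro γ δ h0 hE ho hδ
    obtain ⟨k, hk⟩ := Nat.exists_eq_succ_of_ne_zero h0
    have := (hval δ k).1 (CC_own_true E own L k γ ((hval γ k).2 (by omega)) ho δ hE
      ((hval δ 0).2 (by omega)))
    omega
  · intro γ δ h0 hE ho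
    obtain ⟨k, hk⟩ := Nat.exists_eq_succ_of_ne_zero h0
    by_cases hδ : δ ∈ CC E own L k
    · have := ((GG_good E own (L (k + 1)) (CC E own L k)).2 γ ((hG γ k).2 hk)).1 ho δ hE hδ
      rw [hG] at this
      omega
    · rw [hval] at hδ
      omega

end Abstract

section Plays

theorem playPrefix_succ {α : Type*} (p : ℕ → α) (n : ℕ) :
    playPrefix p (n + 1) = playPrefix p n ++ [p n] := by
  unfold playPrefix
  rw [List.ofFn_succ', List.concat_eq_append]
  simp

theorem playPrefix_prefix {α : Type*} (p : ℕ → α) {m n : ℕ} (h : m ≤ n) :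
    playPrefix p m <+: playPrefix p n := by
  induction n, h using Nat.le_induction with
  | base => exact List.prefix_rfl
  | succ n _ ih => rw [playPrefix_succ]; exact ih.trans (List.prefix_append _ _)

theorem playPrefix_listExtend {α : Type*} (γ : List α) (p : ℕ → α) (m : ℕ) :
    playPrefix (listExtend γ p) (γ.length + m) = γ ++ playPrefix p m := by
  induction m with
  | zero =>
    apply List.ext_getElem
    · simp [playPrefix]
    · intro i h1 h2
      simp [playPrefix] at h1
      simp [playPrefix, listExtend, h1]
  | succ m ih =>
    rw [← Nat.add_assoc, playPrefix_succ, ih, playPrefix_succ, List.append_assoc]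
    simp [listExtend]

theorem playPrefix_inducedPlay {α : Type*} [Inhabited α] (T : Set (List α)) (h0 : [] ∈ T)
    (s : List α → List α) (hs : IsProfile T s) (m : ℕ) :
    iterNode s [] m ∈ T ∧ playPrefix (inducedPlay s) m = iterNode s [] m := by
  induction m with
  | zero => exact ⟨h0, by simp [playPrefix, iterNode]⟩
  | succ m ih =>
    obtain ⟨h1, h2⟩ := ih
    obtain ⟨h3, h4, h5⟩ := hs _ h1
    refine ⟨h3, ?_⟩
    rw [playPrefix_succ, h2]
    have hlen : (iterNode s [] m).length = m := by rw [← h2, playPrefix_length]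
    have hdef : inducedPlay s m = (s (iterNode s [] m)).getD m default := rfl
    rw [hdef]
    show _ = s (iterNode s [] m)
    obtain ⟨t, ht⟩ := h4
    rw [← ht] at h5 ⊢
    have : t.length = 1 := by simpa using h5
    obtain ⟨x, rfl⟩ := List.length_eq_one_iff.1 this
    simp [List.getD, List.getElem?_append, hlen]

theorem outcomes_sub {α A O : Type*} (g : Game α A O) (hT : IsTree g.T) (γ : List α) :
    OutcomesOf (g.sub γ) = g.v '' cylinder g.T γ := by
  ext x
  constructor
  · rintro ⟨p, hp, rfl⟩
    refine ⟨listExtend γ p, ⟨fun m => ?_, ?_⟩, rfl⟩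
    · refine hT (playPrefix_prefix _ (Nat.le_add_left m γ.length)) ?_
      rw [playPrefix_listExtend]
      exact hp m
    · simpa [playPrefix] using playPrefix_listExtend γ p 0
  · rintro ⟨p, ⟨hp, hγ⟩, rfl⟩
    have he : listExtend γ (fun i => p (γ.length + i)) = p := by
      funext i
      by_cases hi : i < γ.length
      · simp only [listExtend, hi, dite_true]
        have h1 : (playPrefix p γ.length)[i]? = some (p i) := by simp [playPrefix, hi]
        rw [hγ, List.getElem?_eq_getElem hi] at h1
        simpa using h1
      · simp only [listExtend, hi, dite_false]
        congr 1
        omega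
    refine ⟨fun i => p (γ.length + i), fun m => ?_, ?_⟩
    · show γ ++ _ ∈ g.T
      rw [← playPrefix_listExtend, he]
      exact hp _
    · show g.v (listExtend γ _) = _
      rw [he]

/-- A play following a profile of a subgame. -/
theorem sub_play {α A O : Type*} [Inhabited α] (g : Game α A O) (hT : IsTree g.T) (γ : List α)
    (hγ : γ ∈ g.T) (s' : List α → List α) (hs' : IsProfile (g.sub γ).T s') :
    listExtend γ (inducedPlay s') ∈ cylinder g.T γ ∧
    ∀ m, playPrefix (listExtend γ (inducedPlay s')) (γ.length + m) = γ ++ iterNode s' [] m := by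
  have h0 : [] ∈ (g.sub γ).T := by simpa [Game.sub] using hγ
  have key : ∀ m, playPrefix (listExtend γ (inducedPlay s')) (γ.length + m)
      = γ ++ iterNode s' [] m := by
    intro m
    rw [playPrefix_listExtend, (playPrefix_inducedPlay _ h0 s' hs' m).2]
  refine ⟨⟨fun m => ?_, ?_⟩, key⟩
  · refine hT (playPrefix_prefix _ (Nat.le_add_left m γ.length)) ?_
    rw [key]
    exact (playPrefix_inducedPlay _ h0 s' hs' m).1
  · simpa [iterNode] using key 0

theorem sub_profile {α A O : Type*} (g : Game α A O) (γ : List α)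
    (s : List α → List α) (hs : IsProfile g.T s) :
    IsProfile (g.sub γ).T (subProfile γ s) ∧
    ∀ δ ∈ (g.sub γ).T, γ ++ subProfile γ s δ = s (γ ++ δ) := by
  have key : ∀ δ ∈ (g.sub γ).T, γ ++ subProfile γ s δ = s (γ ++ δ) := by
    intro δ hδ
    obtain ⟨_, ⟨t, ht⟩, _⟩ := hs (γ ++ δ) hδ
    simp [subProfile, ← ht]
  refine ⟨fun δ hδ => ?_, key⟩
  obtain ⟨h1, h2, h3⟩ := hs (γ ++ δ) hδ
  rw [← key δ hδ] at h1 h2 h3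
  refine ⟨h1, (List.prefix_append_right_inj γ).1 h2, ?_⟩
  simp at h3
  omega

theorem cylinder_nonempty {α : Type*} [Inhabited α] (T : Set (List α)) (hT : IsTree T)
    (hpr : IsPruned T) (γ : List α) (hγ : γ ∈ T) : (cylinder T γ).Nonempty := by
  classical
  have : ∀ γ, ∃ δ, γ ∈ T → δ ∈ treeSucc T γ := by
    intro γ
    by_cases h : γ ∈ T
    · obtain ⟨δ, hδ⟩ := hpr γ h
      exact ⟨δ, fun _ => hδ⟩
    · exact ⟨γ, fun h' => absurd h' h⟩
  choose s hs using this
  let g : Game α Unit Unit := ⟨T, fun _ => (), fun _ => (), fun _ _ _ => True⟩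
  exact ⟨_, (sub_play g hT γ hγ _ (sub_profile g γ s hs).1).1⟩

theorem cylinder_anti {α : Type*} (T : Set (List α)) {γ δ : List α} (h : γ <+: δ) :
    cylinder T δ ⊆ cylinder T γ := by
  rintro p ⟨hp, hδ⟩
  refine ⟨hp, ?_⟩
  have h1 : playPrefix p γ.length <+: δ := by
    conv_rhs => rw [← hδ]
    exact playPrefix_prefix p h.length_le
  exact (List.prefix_of_prefix_length_le h1 h (by simp [playPrefix])).eq_of_length
    (by simp [playPrefix])

end Plays

/-- a two-player game with preferences `y <_a x_n <_a ⋯ <_a x_1` and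
`y <_b x_1 <_b ⋯ <_b x_n` in which every play without a pseudo-leaf prefix has
outcome `y` has a global-Pareto subgame perfect equilibrium.
Players: `true = a`, `false = b`; outcomes: `0 = y`, `i = x_i`. -/
theorem stmt5 {α : Type*} [Inhabited α] (n : ℕ) (g : Game α Bool (Fin (n + 1)))
    (hT : IsTree g.T) (hne : g.T.Nonempty) (hpr : IsPruned g.T)
    (hpa : g.pref true = prefA n) (hpb : g.pref false = prefB n)
    (hy : ∀ p ∈ Body g.T,
      (∀ (k : ℕ) (x : Fin (n + 1)), ¬ IsPseudoLeaf g x (playPrefix p k)) → g.v p = 0) :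
    ∃ s, IsProfile g.T s ∧ IsGPSPE g s := by
  classical
  let E : List α → List α → Prop := fun γ δ => γ ∈ g.T ∧ δ ∈ treeSucc g.T γ
  let L : ℕ → Set (List α) := fun k => {γ | γ ∈ g.T ∧ ∃ x : Fin (n + 1), x.val = k ∧
    g.v '' cylinder g.T γ = {x}}
  have hLpre : ∀ k γ δ, γ ∈ L k → γ <+: δ → δ ∈ g.T → δ ∈ L k := by
    rintro k γ δ ⟨hγ, x, hx, hxo⟩ hE hδ
    refine ⟨hδ, x, hx, ?_⟩
    apply Set.Nonempty.subset_singleton_iff _ |>.1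
    · rw [← hxo]
      exact Set.image_mono (cylinder_anti _ hE)
    · exact (cylinder_nonempty _ hT hpr _ hδ).image _
  have hL : ∀ k γ δ, γ ∈ L k → E γ δ → δ ∈ L k := fun k γ δ hγ hE =>
    hLpre k γ δ hγ hE.2.2.1 hE.2.1
  have hLn : ∀ k, n < k → L k = ∅ := by
    intro k hk
    ext γ
    simp only [Set.mem_empty_iff_false, iff_false]
    rintro ⟨_, x, hx, _⟩
    have := x.2
    omega
  have hdis : ∀ j k γ, γ ∈ L j → γ ∈ L k → j = k := by
    rintro j k γ ⟨_, x, rfl, hx⟩ ⟨_, x', rfl, hx'⟩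
    rw [hx] at hx'
    rw [Set.singleton_injective hx']
  obtain ⟨val, rank, hlive, hleaf, hrank, hoa, hob⟩ := abstract_val E g.d L n hL hLn hdis
  -- plays
  have hstep : ∀ p ∈ Body g.T, ∀ m, E (playPrefix p m) (playPrefix p (m + 1)) := by
    intro p hp m
    exact ⟨hp m, hp (m + 1), playPrefix_prefix p (Nat.le_succ m), by simp [playPrefix_length]⟩
  have hreach : ∀ p ∈ Body g.T, g.v p ≠ 0 → ∀ N, ∃ M, N ≤ M ∧
      playPrefix p M ∈ L (g.v p).val := by
    intro p hp hv N
    have : ¬ ∀ (k : ℕ) (x : Fin (n + 1)), ¬ IsPseudoLeaf g x (playPrefix p k) :=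
      fun h => hv (hy p hp h)
    push Not at this
    obtain ⟨k, x, h1, h2, _⟩ := this
    rw [outcomes_sub g hT] at h2
    have hx : g.v p = x := by
      have : g.v p ∈ g.v '' cylinder g.T (playPrefix p k) :=
        ⟨p, ⟨hp, by rw [playPrefix_length]⟩, rfl⟩
      rw [h2] at this
      exact this
    refine ⟨max N k, le_max_left _ _, ?_⟩
    refine hLpre _ (playPrefix p k) _ ?_ (playPrefix_prefix p (le_max_right _ _)) (hp _)
    exact ⟨h1, x, by rw [hx], h2⟩
  have hplive : ∀ p ∈ Body g.T, g.v p ≠ 0 → ∀ N, val (playPrefix p N) ≠ 0 := by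
    intro p hp hv N
    obtain ⟨M, hM, hML⟩ := hreach p hp hv N
    rw [hlive]
    have hb : ∃ m, Reach E Set.univ (Lgt L 0) m (playPrefix p M) :=
      ⟨0, .base _ trivial ⟨_, Nat.pos_of_ne_zero (fun h => hv (Fin.ext h)), hML⟩⟩
    clear hML
    induction M, hM using Nat.le_induction with
    | base => exact hb
    | succ M _ ih =>
      obtain ⟨m, hm⟩ := hb
      exact ih ⟨m + 1, .step _ _ _ trivial (hstep p hp M) hm⟩
  have hclive : ∀ γ, ∀ p ∈ cylinder g.T γ, g.v p ≠ 0 → val γ ≠ 0 := by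
    intro γ p hp hv
    have := hplive p hp.1 hv γ.length
    rwa [hp.2] at this
  -- strategy
  have hsex : ∀ γ, ∃ δ, γ ∈ g.T → δ ∈ treeSucc g.T γ ∧ val δ = val γ ∧
      (val γ ≠ 0 → γ ∈ L (val γ) ∨ rank δ < rank γ) := by
    intro γ
    by_cases hγ : γ ∈ g.T
    swap
    · exact ⟨γ, fun h => absurd h hγ⟩
    obtain ⟨δ, hδ⟩ := hpr γ hγ
    by_cases h0 : val γ = 0
    · refine ⟨δ, fun _ => ⟨hδ, ?_, fun h => absurd h0 h⟩⟩
      rw [h0]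
      by_contra hne
      obtain ⟨m, hm⟩ := (hlive δ).1 hne
      exact (hlive γ).2 ⟨m + 1, .step _ _ _ trivial ⟨hγ, hδ⟩ hm⟩ h0
    · rcases hrank γ h0 with h | ⟨δ', hE, hv, hr⟩
      · exact ⟨δ, fun _ => ⟨hδ, hleaf δ _ (Nat.pos_of_ne_zero h0) (hL _ _ _ h ⟨hγ, hδ⟩),
          fun _ => Or.inl h⟩⟩
      · exact ⟨δ', fun _ => ⟨hE.2, hv, fun _ => Or.inr hr⟩⟩
  choose s hs using hsex
  have hsP : IsProfile g.T s := fun γ hγ => (hs γ hγ).1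
  -- the induced play
  have hinit : ∀ γ ∈ g.T, listExtend γ (inducedPlay (subProfile γ s)) ∈ cylinder g.T γ ∧
      ∀ m, playPrefix (listExtend γ (inducedPlay (subProfile γ s))) (γ.length + (m + 1)) =
        s (playPrefix (listExtend γ (inducedPlay (subProfile γ s))) (γ.length + m)) := by
    intro γ hγ
    obtain ⟨h1, h2⟩ := sub_profile g γ s hsP
    obtain ⟨h3, h4⟩ := sub_play g hT γ hγ _ h1
    refine ⟨h3, fun m => ?_⟩
    rw [h4, h4]
    refine h2 _ ?_
    show γ ++ _ ∈ g.T
    rw [← h4]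
    exact h3.1 _
  have hout : ∀ γ ∈ g.T, (subOutcome g s γ).val = val γ := by
    intro γ hγ
    show (g.v (listExtend γ (inducedPlay (subProfile γ s)))).val = val γ
    obtain ⟨hc, hst⟩ := hinit γ hγ
    generalize listExtend γ (inducedPlay (subProfile γ s)) = q at hc hst
    by_cases h0 : val γ = 0
    · by_contra hne
      rw [h0] at hne
      exact hclive γ q hc (fun h => hne (by rw [h]; rfl)) h0
    · have hvq : ∀ m, val (playPrefix q (γ.length + m)) = val γ := by
        intro m
        induction m with
        | zero => rw [Nat.add_zero, hc.2]
        | succ m ih => rw [hst, (hs _ (hc.1 _)).2.1, ih]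
      have hfin : ∀ r m, rank (playPrefix q (γ.length + m)) ≤ r →
          ∃ m, playPrefix q (γ.length + m) ∈ L (val γ) := by
        intro r
        induction r with
        | zero =>
          intro m hm
          rcases (hs _ (hc.1 (γ.length + m))).2.2 (by rw [hvq]; exact h0) with h | h
          · rw [hvq] at h; exact ⟨m, h⟩
          · omega
        | succ r ih =>
          intro m hm
          rcases (hs _ (hc.1 (γ.length + m))).2.2 (by rw [hvq]; exact h0) with h | h
          · rw [hvq] at h; exact ⟨m, h⟩
          · refine ih (m + 1) ?_
            rw [hst]
            omega
      obtain ⟨m, _, x, hx, hxo⟩ := hfin _ 0 le_rfl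
      have : g.v q ∈ g.v '' cylinder g.T (playPrefix q (γ.length + m)) :=
        ⟨q, ⟨hc.1, by rw [playPrefix_length]⟩, rfl⟩
      rw [hxo] at this
      rw [← hx, Set.mem_singleton_iff.1 this]
  refine ⟨s, hsP, ?_, ?_⟩
  · rintro γ hγ ⟨a, s', hs', hdev, hpref⟩
    obtain ⟨hc, hit⟩ := sub_play g hT γ hγ s' hs'
    have hu := hout γ hγ
    change g.pref a (subOutcome g s γ) (g.v (listExtend γ (inducedPlay s'))) at hpref
    have hmove : ∀ m, playPrefix (listExtend γ (inducedPlay s')) (γ.length + (m + 1)) =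
        s (playPrefix (listExtend γ (inducedPlay s')) (γ.length + m)) ∨
        g.d (playPrefix (listExtend γ (inducedPlay s')) (γ.length + m)) = a := by
      intro m
      have hmem : iterNode s' [] m ∈ (g.sub γ).T := by
        show γ ++ _ ∈ g.T
        rw [← hit]
        exact hc.1 _
      rw [hit, hit]
      by_cases h : subProfile γ s (iterNode s' [] m) = s' (iterNode s' [] m)
      · left
        rw [← (sub_profile g γ s hsP).2 _ hmem, h]
        rfl
      · right
        exact hdev _ hmem h
    generalize listExtend γ (inducedPlay s') = p at hc hmove hpref
    generalize subOutcome g s γ = u at hu hpref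
    have hv0 : g.v p ≠ 0 := by
      intro h
      cases a
      · rw [hpb, h] at hpref
        exact absurd hpref (Fin.not_lt_zero _)
      · rw [hpa] at hpref
        exact hpref.1 h
    obtain ⟨M, hM, hML⟩ := hreach p hc.1 hv0 γ.length
    have hvM := hleaf _ _ (Nat.pos_of_ne_zero (fun h => hv0 (Fin.ext h))) hML
    obtain ⟨m, rfl⟩ := Nat.exists_eq_add_of_le hM
    have hγ0 := hclive γ p hc hv0
    cases a
    · have hle : ∀ m, val (playPrefix p (γ.length + m)) ≤ val γ := by
        intro m
        induction m with
        | zero => rw [Nat.add_zero, hc.2]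
        | succ m ih =>
          refine le_trans ?_ ih
          rcases hmove m with h | h
          · rw [h, (hs _ (hc.1 _)).2.1]
          · exact hob _ _ (hplive p hc.1 hv0 _) (hstep p hc.1 _) h
      have := hle m
      rw [hpb] at hpref
      have hlt : u.val < (g.v p).val := hpref
      omega
    · have hle : ∀ m, val γ ≤ val (playPrefix p (γ.length + m)) := by
        intro m
        induction m with
        | zero => rw [Nat.add_zero, hc.2]
        | succ m ih =>
          refine le_trans ih ?_
          rcases hmove m with h | h
          · rw [h, (hs _ (hc.1 _)).2.1]
          · exact hoa _ _ (hplive p hc.1 hv0 _) (hstep p hc.1 _) h (hplive p hc.1 hv0 _)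
      have := hle m
      rw [hpa] at hpref
      rcases hpref.2 with h | h
      · rw [h] at hu
        exact hγ0 hu.symm
      · have hlt : (g.v p).val < u.val := h
        omega
  · intro γ hγ
    have hu := hout γ hγ
    have hmem : subOutcome g s γ ∈ g.v '' cylinder g.T γ := ⟨_, (hinit γ hγ).1, rfl⟩
    rw [outcomes_sub g hT]
    refine ⟨hmem, ?_⟩
    rintro y ⟨p, hp, rfl⟩ a hpref
    generalize subOutcome g s γ = u at hu hpref
    have hv0 : g.v p ≠ 0 := by
      intro h
      cases a
      · rw [hpb, h] at hpref
        exact absurd hpref (Fin.not_lt_zero _)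
      · rw [hpa] at hpref
        exact hpref.1 h
    have hu0 : u ≠ 0 := by
      rintro rfl
      exact hclive γ p hp hv0 hu.symm
    cases a
    · refine ⟨true, ?_⟩
      rw [hpb] at hpref
      rw [hpa]
      exact ⟨hu0, Or.inr hpref⟩
    · refine ⟨false, ?_⟩
      rw [hpa] at hpref
      rw [hpb]
      exact hpref.2.resolve_left hu0
end
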